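/- arXiv:1608.04810 — 10 statements merged into one kernel-verified Lean document; each statement's English description precedes it below -/
import Mathlib

section
/- Let σ be a 2-plane in V with unit normal vector u = c₁e₁ + c₂e₂ + c₃e₃ (i.e. u is a unit vector orthogonal to σ). Then sec(σ) = c₁²λ₂₃ + c₂²λ₁₃ + c₃²λ₁₂. -/
open scoped RealInnerProductSpace

/-- An algebraic curvature tensor on a real inner product space: a quadrilinear map
satisfying the symmetries of a Riemann curvature tensor and the first Bianchi identity. -/
structure IsAlgCurvatureTensor {V : Type*} [NormedAddCommGroup V] [InnerProductSpace ℝ V]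
    (R : V →ₗ[ℝ] V →ₗ[ℝ] V →ₗ[ℝ] V →ₗ[ℝ] ℝ) : Prop where
  antisym_fst : ∀ X Y Z W : V, R X Y Z W = - R Y X Z W
  antisym_snd : ∀ X Y Z W : V, R X Y Z W = - R X Y W Z
  pair_symm : ∀ X Y Z W : V, R X Y Z W = R Z W X Y
  bianchi : ∀ X Y Z W : V, R X Y Z W + R Y Z X W + R Z X Y W = 0

/-- The value of an antisymmetric bilinear form on two combinations of three vectors, in terms of
the `2 × 2` minors of the coefficients. -/
lemma LinearMap.antisymm_apply_combination {V : Type*} [AddCommGroup V] [Module ℝ V]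
    (B : V →ₗ[ℝ] V →ₗ[ℝ] ℝ) (hB : ∀ v w, B v w = -B w v)
    (e : Fin 3 → V) (x y : Fin 3 → ℝ) :
    B (∑ i, x i • e i) (∑ i, y i • e i) =
      (x 0 * y 1 - x 1 * y 0) * B (e 0) (e 1) + (x 0 * y 2 - x 2 * y 0) * B (e 0) (e 2)
        + (x 1 * y 2 - x 2 * y 1) * B (e 1) (e 2) := by
  have hself : ∀ v, B v v = 0 := fun v => self_eq_neg.mp (hB v v)
  simp only [Fin.sum_univ_three, map_add, map_smul, LinearMap.add_apply, LinearMap.smul_apply,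
    hself, smul_eq_mul, hB (e 1) (e 0), hB (e 2) (e 0), hB (e 2) (e 1)]
  ring

/-- The squared minors of the first two rows of an orthogonal `3 × 3` matrix are the squared
entries of the third row. -/
lemma sq_minor_eq_sq_of_orthonormal_rows (x y c : Fin 3 → ℝ)
    (hxx : x ⬝ᵥ x = 1) (hyy : y ⬝ᵥ y = 1) (hcc : c ⬝ᵥ c = 1)
    (hxy : x ⬝ᵥ y = 0) (hxc : x ⬝ᵥ c = 0) (hyc : y ⬝ᵥ c = 0) :
    (x 1 * y 2 - x 2 * y 1) ^ 2 = c 0 ^ 2 ∧ (x 0 * y 2 - x 2 * y 0) ^ 2 = c 1 ^ 2 ∧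
      (x 0 * y 1 - x 1 * y 0) ^ 2 = c 2 ^ 2 := by
  have hrows : Matrix.of ![x, y, c] * (Matrix.of ![x, y, c]).transpose = 1 := by
    ext i j
    change ![x, y, c] i ⬝ᵥ ![x, y, c] j = _
    fin_cases i <;> fin_cases j <;>
      simp [hxx, hyy, hcc, hxy, hxc, hyc, dotProduct_comm y x, dotProduct_comm c x,
        dotProduct_comm c y]
  have hcol : ∀ k, x k ^ 2 + y k ^ 2 + c k ^ 2 = 1 := fun k => by
    have h := congrArg (fun A : Matrix (Fin 3) (Fin 3) ℝ => A k k) (mul_eq_one_comm.mp hrows)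
    simpa [Matrix.mul_apply, Fin.sum_univ_three, ← sq] using h
  simp only [dotProduct, Fin.sum_univ_three] at hxx hyy hxy
  have h0 := hcol 0
  have h1 := hcol 1
  have h2 := hcol 2
  refine ⟨?_, ?_, ?_⟩
  · linear_combination (y 1 ^ 2 + y 2 ^ 2) * hxx + (1 - x 0 ^ 2) * hyy
      - (x 1 * y 1 + x 2 * y 2 - x 0 * y 0) * hxy - h0
  · linear_combination (y 0 ^ 2 + y 2 ^ 2) * hxx + (1 - x 1 ^ 2) * hyy
      - (x 0 * y 0 + x 2 * y 2 - x 1 * y 1) * hxy - h1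
  · linear_combination (y 0 ^ 2 + y 1 ^ 2) * hxx + (1 - x 2 ^ 2) * hyy
      - (x 0 * y 0 + x 1 * y 1 - x 2 * y 2) * hxy - h2

/-- If a 2-plane `σ` in a Ricci-diagonalized 3-dimensional inner product space has unit
normal vector `u = c₁e₁ + c₂e₂ + c₃e₃`, then `sec(σ) = c₁²λ₂₃ + c₂²λ₁₃ + c₃²λ₁₂`,
where `sec(σ) = R(X,Y,Y,X)` for any orthonormal basis `{X, Y}` of `σ`. -/
theorem sec_of_normal {V : Type*} [NormedAddCommGroup V] [InnerProductSpace ℝ V]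
    (hdim : Module.finrank ℝ V = 3)
    (R : V →ₗ[ℝ] V →ₗ[ℝ] V →ₗ[ℝ] V →ₗ[ℝ] ℝ) (hR : IsAlgCurvatureTensor R)
    (e : Fin 3 → V) (he : Orthonormal ℝ e)
    (hd1 : R (e 0) (e 1) (e 2) (e 0) = 0)
    (hd2 : R (e 0) (e 1) (e 1) (e 2) = 0)
    (hd3 : R (e 0) (e 2) (e 2) (e 1) = 0)
    (c₁ c₂ c₃ : ℝ) (u X Y : V)
    (hu : u = c₁ • e 0 + c₂ • e 1 + c₃ • e 2) (hunorm : ‖u‖ = 1)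
    (hXnorm : ‖X‖ = 1) (hYnorm : ‖Y‖ = 1) (hXY : ⟪X, Y⟫ = 0)
    (hXu : ⟪X, u⟫ = 0) (hYu : ⟪Y, u⟫ = 0) :
    R X Y Y X = c₁ ^ 2 * R (e 1) (e 2) (e 2) (e 1) + c₂ ^ 2 * R (e 0) (e 2) (e 2) (e 0)
      + c₃ ^ 2 * R (e 0) (e 1) (e 1) (e 0) := by
  obtain ⟨b, hb⟩ : ∃ b : OrthonormalBasis (Fin 3) ℝ V, ⇑b = e := by
    refine ⟨OrthonormalBasis.mk he ?_, OrthonormalBasis.coe_mk _ _⟩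
    exact (he.linearIndependent.span_eq_top_of_card_eq_finrank (by simp [hdim])).ge
  obtain ⟨x, rfl⟩ : ∃ x : Fin 3 → ℝ, X = ∑ i, x i • e i :=
    ⟨fun i => ⟪e i, X⟫, by rw [← hb, b.sum_repr' X]⟩
  obtain ⟨y, rfl⟩ : ∃ y : Fin 3 → ℝ, Y = ∑ i, y i • e i :=
    ⟨fun i => ⟪e i, Y⟫, by rw [← hb, b.sum_repr' Y]⟩
  replace hu : u = ∑ i, ![c₁, c₂, c₃] i • e i := by simpa [Fin.sum_univ_three] using hu
  have hinner : ∀ a d : Fin 3 → ℝ, ⟪∑ i, a i • e i, ∑ i, d i • e i⟫ = a ⬝ᵥ d := fun a d => by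
    simp [he.inner_sum, dotProduct]
  have hunit : ∀ a : Fin 3 → ℝ, ‖∑ i, a i • e i‖ = 1 → a ⬝ᵥ a = 1 := fun a ha => by
    rw [← hinner, real_inner_self_eq_norm_sq, ha, one_pow]
  rw [hu] at hunorm hXu hYu
  rw [hinner] at hXY hXu hYu
  obtain ⟨h0, h1, h2⟩ := sq_minor_eq_sq_of_orthonormal_rows x y ![c₁, c₂, c₃] (hunit _ hXnorm)
    (hunit _ hYnorm) (hunit _ hunorm) hXY hXu hYu
  simp only [Matrix.cons_val] at h0 h1 h2
  have hexp := fun v w => LinearMap.antisymm_apply_combination (R v w) (hR.antisym_snd v w) e x y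
  rw [hR.antisym_snd, hexp]
  simp only [hR.pair_symm (∑ i, x i • e i) (∑ i, y i • e i), hexp]
  rw [← h0, ← h1, ← h2, hR.antisym_snd (e 1) (e 2) (e 2), hR.antisym_snd (e 0) (e 2) (e 2) (e 0),
    hR.antisym_snd (e 0) (e 1) (e 1) (e 0), hR.pair_symm (e 0) (e 2) (e 0) (e 1),
    hR.pair_symm (e 1) (e 2) (e 0) (e 1), hR.pair_symm (e 1) (e 2) (e 0) (e 2), hd2]
  rw [hR.antisym_snd] at hd1 hd3
  rw [neg_eq_zero.mp hd1, neg_eq_zero.mp hd3]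
  ring
end

section
/- Assume λ = ε < Λ. Let σ be a 2-plane in V with unit normal vector u = c₁e₁ + c₂e₂ + c₃e₃. Then sec(σ) = ε if and only if c₁ = 0. -/
open scoped RealInnerProductSpace

/-- An orthonormal family with as many vectors as the dimension is an orthonormal basis. -/
theorem Orthonormal.exists_orthonormalBasis_of_finrank_eq {V ι : Type*} [NormedAddCommGroup V]
    [InnerProductSpace ℝ V] [Fintype ι] [Nonempty ι] {e : ι → V} (he : Orthonormal ℝ e)
    (hdim : Module.finrank ℝ V = Fintype.card ι) :
    ∃ b : OrthonormalBasis ι ℝ V, ⇑b = e := by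
  have : FiniteDimensional ℝ V := .of_finrank_pos (hdim ▸ Fintype.card_pos)
  have he_span := he.linearIndependent.span_eq_top_of_card_eq_finrank' hdim.symm
  exact ⟨.mk he he_span.ge, OrthonormalBasis.coe_mk he he_span.ge⟩

/-- An alternating bilinear map, evaluated on two combinations of three vectors, expands in
the `2 × 2` minors of the coefficients. -/
theorem LinearMap.alternating_apply_fin_three {V M : Type*} [AddCommGroup V] [Module ℝ V]
    [AddCommGroup M] [Module ℝ M] (B : V →ₗ[ℝ] V →ₗ[ℝ] M) (hB : ∀ v w, B v w = -B w v)
    (e : Fin 3 → V) (x y : Fin 3 → ℝ) :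
    B (∑ i, x i • e i) (∑ i, y i • e i) =
      (x 1 * y 2 - x 2 * y 1) • B (e 1) (e 2) + (x 2 * y 0 - x 0 * y 2) • B (e 2) (e 0)
        + (x 0 * y 1 - x 1 * y 0) • B (e 0) (e 1) := by
  have hB_self (v : V) : B v v = 0 := by
    have : (2 : ℝ) • B v v = 0 := by rw [two_smul, ← eq_neg_iff_add_eq_zero, ← hB]
    simpa using this
  simp only [Fin.sum_univ_three, map_add, map_smul, LinearMap.add_apply, LinearMap.smul_apply,
    hB_self, hB (e 1) (e 0), hB (e 2) (e 1), hB (e 0) (e 2)]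
  module

/-- The curvature `R(X, Y, Y, X)` in a basis diagonalizing the Ricci tensor. -/
theorem IsAlgCurvatureTensor.apply_eq_of_diagonal {V : Type*} [NormedAddCommGroup V]
    [InnerProductSpace ℝ V] {R : V →ₗ[ℝ] V →ₗ[ℝ] V →ₗ[ℝ] V →ₗ[ℝ] ℝ}
    (hR : IsAlgCurvatureTensor R) (e : Fin 3 → V)
    (hd1 : R (e 0) (e 1) (e 2) (e 0) = 0) (hd2 : R (e 0) (e 1) (e 1) (e 2) = 0)
    (hd3 : R (e 0) (e 2) (e 2) (e 1) = 0) (x y : Fin 3 → ℝ) :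
    R (∑ i, x i • e i) (∑ i, y i • e i) (∑ i, y i • e i) (∑ i, x i • e i) =
      (x 1 * y 2 - x 2 * y 1) ^ 2 * R (e 1) (e 2) (e 2) (e 1)
        + (x 2 * y 0 - x 0 * y 2) ^ 2 * R (e 0) (e 2) (e 2) (e 0)
        + (x 0 * y 1 - x 1 * y 0) ^ 2 * R (e 0) (e 1) (e 1) (e 0) := by
  have expand_snd (v w : V) := (R v w).alternating_apply_fin_three (hR.antisym_snd v w) e y x
  have expand_fst := LinearMap.alternating_apply_fin_three (M := V →ₗ[ℝ] V →ₗ[ℝ] ℝ) R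
    (fun v w ↦ by ext Z W; exact hR.antisym_fst v w Z W) e x y
  rw [expand_fst]
  simp only [LinearMap.add_apply, LinearMap.smul_apply, smul_eq_mul, expand_snd]
  rw [hR.antisym_snd (e 1) (e 2) (e 1) (e 2), hR.antisym_fst (e 2) (e 0) (e 2) (e 0),
    hR.antisym_snd (e 0) (e 1) (e 0) (e 1), hR.pair_symm (e 1) (e 2) (e 0) (e 1),
    hR.pair_symm (e 2) (e 0) (e 0) (e 1), hR.antisym_fst (e 2) (e 0) (e 1) (e 2),
    hR.antisym_snd (e 0) (e 2) (e 1) (e 2), hR.pair_symm (e 1) (e 2) (e 2) (e 0),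
    hR.antisym_fst (e 2) (e 0) (e 1) (e 2), hR.antisym_snd (e 0) (e 2) (e 1) (e 2),
    hd1, hd2, hd3]
  ring

/-- In the case `λ = ε < Λ`, a 2-plane `σ` with unit normal `u = c₁e₁ + c₂e₂ + c₃e₃`
has `sec(σ) = ε` if and only if `c₁ = 0`. -/
theorem sec_eq_eps_iff_extremal_minus
    {V : Type*} [NormedAddCommGroup V] [InnerProductSpace ℝ V]
    (hdim : Module.finrank ℝ V = 3)
    (R : V →ₗ[ℝ] V →ₗ[ℝ] V →ₗ[ℝ] V →ₗ[ℝ] ℝ) (hR : IsAlgCurvatureTensor R)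
    (e : Fin 3 → V) (he : Orthonormal ℝ e)
    (ε : ℝ) (hε : ε = -1 ∨ ε = 0 ∨ ε = 1)
    (hd1 : R (e 0) (e 1) (e 2) (e 0) = 0)
    (hd2 : R (e 0) (e 1) (e 1) (e 2) = 0)
    (hd3 : R (e 0) (e 2) (e 2) (e 1) = 0)
    (lam Lam : ℝ)
    (hlam : lam = R (e 0) (e 2) (e 2) (e 0))
    (hLam : Lam = R (e 1) (e 2) (e 2) (e 1))
    (h12 : R (e 0) (e 1) (e 1) (e 0) = ε)
    (horder : lam ≤ ε ∧ ε ≤ Lam)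
    (hcase : lam = ε ∧ ε < Lam)
    (c₁ c₂ c₃ : ℝ) (u X Y : V)
    (hu : u = c₁ • e 0 + c₂ • e 1 + c₃ • e 2) (hunorm : ‖u‖ = 1)
    (hXnorm : ‖X‖ = 1) (hYnorm : ‖Y‖ = 1) (hXY : ⟪X, Y⟫ = 0)
    (hXu : ⟪X, u⟫ = 0) (hYu : ⟪Y, u⟫ = 0)
    :
    R X Y Y X = ε ↔ c₁ = 0 := by
  obtain ⟨b, hb⟩ := he.exists_orthonormalBasis_of_finrank_eq (by simpa using hdim)
  have expand (v : V) : ∑ i, ⟪e i, v⟫ • e i = v := by simpa [hb] using b.sum_repr' v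
  have inner_eq (v w : V) :
      ⟪e 0, v⟫ * ⟪e 0, w⟫ + ⟪e 1, v⟫ * ⟪e 1, w⟫ + ⟪e 2, v⟫ * ⟪e 2, w⟫ = ⟪v, w⟫ := by
    simpa [hb, Fin.sum_univ_three, real_inner_comm] using b.sum_inner_mul_inner v w
  have hu_zero : ⟪e 0, u⟫ = c₁ := by
    simp only [hu, inner_add_right, real_inner_smul_right, orthonormal_iff_ite.mp he]
    simp
  have hframe : Orthonormal ℝ ![u, X, Y] := by
    simp [orthonormal_vecCons_iff, Fin.forall_fin_two, hunorm, hXnorm, hYnorm, hXY,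
      inner_eq_zero_symm.mp hXu, inner_eq_zero_symm.mp hYu]
  obtain ⟨f, hf⟩ := hframe.exists_orthonormalBasis_of_finrank_eq (by simpa using hdim)
  have hcol : c₁ ^ 2 + ⟪e 0, X⟫ ^ 2 + ⟪e 0, Y⟫ ^ 2 = 1 := by
    have h := f.sum_inner_mul_inner (e 0) (e 0)
    rw [real_inner_self_eq_norm_sq, he.1 0] at h
    simp only [hf, Fin.sum_univ_three, Matrix.cons_val, real_inner_comm (e 0), hu_zero] at h
    linarith
  have hsec := hR.apply_eq_of_diagonal e hd1 hd2 hd3 (fun i ↦ ⟪e i, X⟫) (fun i ↦ ⟪e i, Y⟫)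
  simp only [expand, ← hlam, ← hLam, h12, hcase.1] at hsec
  have hXX := inner_eq X X
  have hYY := inner_eq Y Y
  have hXY' := inner_eq X Y
  rw [real_inner_self_eq_norm_sq, hXnorm] at hXX
  rw [real_inner_self_eq_norm_sq, hYnorm] at hYY
  rw [hXY] at hXY'
  generalize ⟪e 0, X⟫ = x₀, ⟪e 1, X⟫ = x₁, ⟪e 2, X⟫ = x₂ at *
  generalize ⟪e 0, Y⟫ = y₀, ⟪e 1, Y⟫ = y₁, ⟪e 2, Y⟫ = y₂ at *
  have hminor : (x₁ * y₂ - x₂ * y₁) ^ 2 = c₁ ^ 2 := by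
    linear_combination (y₁ * y₁ + y₂ * y₂) * hXX + (1 - x₀ ^ 2) * hYY -
      (x₁ * y₁ + x₂ * y₂ - x₀ * y₀) * hXY' - hcol
  have hsum : (x₁ * y₂ - x₂ * y₁) ^ 2 + (x₂ * y₀ - x₀ * y₂) ^ 2 + (x₀ * y₁ - x₁ * y₀) ^ 2 = 1 := by
    linear_combination (y₀ * y₀ + y₁ * y₁ + y₂ * y₂) * hXX + hYY -
      (x₀ * y₀ + x₁ * y₁ + x₂ * y₂) * hXY'
  have hsec_sub : R X Y Y X - ε = (Lam - ε) * c₁ ^ 2 := by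
    linear_combination hsec + ε * hsum + (Lam - ε) * hminor
  rw [← sub_eq_zero, hsec_sub]
  simp [sub_ne_zero.mpr hcase.2.ne']
end

section
/- Let σ be a 2-plane in V with unit normal vector u = c₁e₁ + c₂e₂ + c₃e₃. Then sec(σ) = ε if and only if c₁ = m·c₂ or c₁ = −m·c₂. -/
open scoped RealInnerProductSpace

/-- An alternating bilinear map evaluated on two combinations of three vectors, in terms of
Plücker coordinates. -/
theorem LinearMap.IsAlt.apply_combination_three {V M : Type*} [AddCommGroup V] [Module ℝ V]
    [AddCommGroup M] [Module ℝ M] {B : V →ₗ[ℝ] V →ₗ[ℝ] M} (hB : B.IsAlt)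
    (a b c : V) (x₁ x₂ x₃ y₁ y₂ y₃ : ℝ) :
    B (x₁ • a + x₂ • b + x₃ • c) (y₁ • a + y₂ • b + y₃ • c) =
      (x₁ * y₂ - x₂ * y₁) • B a b + (x₁ * y₃ - x₃ * y₁) • B a c
        + (x₂ * y₃ - x₃ * y₂) • B b c := by
  have hba : B b a = -B a b := (hB.neg a b).symm
  have hca : B c a = -B a c := (hB.neg a c).symm
  have hcb : B c b = -B b c := (hB.neg b c).symm
  simp only [map_add, map_smul, LinearMap.add_apply, LinearMap.smul_apply, hB.self_eq_zero,
    hba, hca, hcb]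
  module

/-- The sectional curvature form in a basis diagonalizing the Ricci tensor, in terms of Plücker
coordinates. -/
theorem IsAlgCurvatureTensor.apply_of_diagonal {V : Type*} [NormedAddCommGroup V]
    [InnerProductSpace ℝ V] {R : V →ₗ[ℝ] V →ₗ[ℝ] V →ₗ[ℝ] V →ₗ[ℝ] ℝ}
    (hR : IsAlgCurvatureTensor R) {a b c : V}
    (habca : R a b c a = 0) (habbc : R a b b c = 0) (haccb : R a c c b = 0)
    (x₁ x₂ x₃ y₁ y₂ y₃ : ℝ) {X Y : V}
    (hX : X = x₁ • a + x₂ • b + x₃ • c) (hY : Y = y₁ • a + y₂ • b + y₃ • c) :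
    R X Y Y X = (x₁ * y₂ - x₂ * y₁) ^ 2 * R a b b a + (x₁ * y₃ - x₃ * y₁) ^ 2 * R a c c a
      + (x₂ * y₃ - x₃ * y₂) ^ 2 * R b c c b := by
  have hfst : R.IsAlt := fun Z => by
    ext W T
    have := hR.antisym_fst Z Z W T
    simp only [LinearMap.zero_apply]
    linarith
  have hsnd (Z W : V) : (R Z W).IsAlt := fun T => by
    have := hR.antisym_snd Z W T T
    linarith
  have habac : R a b a c = 0 := by rw [hR.antisym_snd, habca, neg_zero]
  have hacbc : R a c b c = 0 := by rw [hR.antisym_snd, haccb, neg_zero]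
  have hacab : R a c a b = 0 := by rw [hR.pair_symm, habac]
  have hbcab : R b c a b = 0 := by rw [hR.pair_symm, habbc]
  have hbcac : R b c a c = 0 := by rw [hR.pair_symm, hacbc]
  have hRXY := LinearMap.IsAlt.apply_combination_three (M := V →ₗ[ℝ] V →ₗ[ℝ] ℝ) hfst
    a b c x₁ x₂ x₃ y₁ y₂ y₃
  rw [hR.antisym_snd X Y Y X, hR.antisym_snd a b b a, hR.antisym_snd a c c a,
    hR.antisym_snd b c c b, hX, hY, hRXY]
  simp only [LinearMap.add_apply, LinearMap.smul_apply, (hsnd _ _).apply_combination_three,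
    habac, habbc, hacab, hacbc, hbcab, hbcac, smul_eq_mul]
  ring

/-- The squared Plücker coordinates of the first two rows of an orthogonal matrix of size three
are the squared entries of the third row. -/
theorem sq_minor_eq_sq_of_orthonormal_rows_s4 {x₁ x₂ x₃ y₁ y₂ y₃ c₁ c₂ c₃ : ℝ}
    (hx : x₁ ^ 2 + x₂ ^ 2 + x₃ ^ 2 = 1) (hy : y₁ ^ 2 + y₂ ^ 2 + y₃ ^ 2 = 1)
    (hc : c₁ ^ 2 + c₂ ^ 2 + c₃ ^ 2 = 1) (hxy : x₁ * y₁ + x₂ * y₂ + x₃ * y₃ = 0)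
    (hxc : x₁ * c₁ + x₂ * c₂ + x₃ * c₃ = 0) (hyc : y₁ * c₁ + y₂ * c₂ + y₃ * c₃ = 0) :
    (x₁ * y₂ - x₂ * y₁) ^ 2 = c₃ ^ 2 ∧ (x₁ * y₃ - x₃ * y₁) ^ 2 = c₂ ^ 2 ∧
      (x₂ * y₃ - x₃ * y₂) ^ 2 = c₁ ^ 2 := by
  let Q : Matrix (Fin 3) (Fin 3) ℝ := !![x₁, x₂, x₃; y₁, y₂, y₃; c₁, c₂, c₃]
  have hrows : Q * Q.transpose = 1 := by
    ext i j
    fin_cases i <;> fin_cases j <;>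
      simp [Q, Matrix.mul_apply, Fin.sum_univ_three] <;> linarith
  have hcols : Q.transpose * Q = 1 := mul_eq_one_comm.mp hrows
  have entry (i j : Fin 3) := congrFun (congrFun hcols i) j
  have h₁₁ : x₁ * x₁ + y₁ * y₁ + c₁ * c₁ = 1 := by
    simpa [Q, Matrix.mul_apply, Fin.sum_univ_three] using entry 0 0
  have h₂₂ : x₂ * x₂ + y₂ * y₂ + c₂ * c₂ = 1 := by
    simpa [Q, Matrix.mul_apply, Fin.sum_univ_three] using entry 1 1
  have h₃₃ : x₃ * x₃ + y₃ * y₃ + c₃ * c₃ = 1 := by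
    simpa [Q, Matrix.mul_apply, Fin.sum_univ_three] using entry 2 2
  have h₁₂ : x₁ * x₂ + y₁ * y₂ + c₁ * c₂ = 0 := by
    simpa [Q, Matrix.mul_apply, Fin.sum_univ_three] using entry 0 1
  have h₁₃ : x₁ * x₃ + y₁ * y₃ + c₁ * c₃ = 0 := by
    simpa [Q, Matrix.mul_apply, Fin.sum_univ_three] using entry 0 2
  have h₂₃ : x₂ * x₃ + y₂ * y₃ + c₂ * c₃ = 0 := by
    simpa [Q, Matrix.mul_apply, Fin.sum_univ_three] using entry 1 2
  have minor {p q r s d f g : ℝ} (hp : p * p + r * r + d * d = 1)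
      (hq : q * q + s * s + f * f = 1) (hpq : p * q + r * s + d * f = 0)
      (hnorm : g ^ 2 + d ^ 2 + f ^ 2 = 1) : (p * s - q * r) ^ 2 = g ^ 2 := by
    have hp' : p * p + r * r = 1 - d * d := by linarith
    have hq' : q * q + s * s = 1 - f * f := by linarith
    have hpq' : p * q + r * s = -(d * f) := by linarith
    calc (p * s - q * r) ^ 2
        = (p * p + r * r) * (q * q + s * s) - (p * q + r * s) ^ 2 := by ring
      _ = g ^ 2 := by rw [hp', hq', hpq']; linarith
  exact ⟨minor h₁₁ h₂₂ h₁₂ (by linarith), minor h₁₁ h₃₃ h₁₃ (by linarith),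
    minor h₂₂ h₃₃ h₂₃ hc⟩

/-- Inner products of combinations of an orthonormal triple. -/
theorem Orthonormal.inner_combination_three {V : Type*} [NormedAddCommGroup V]
    [InnerProductSpace ℝ V] {e : Fin 3 → V} (he : Orthonormal ℝ e) (x₁ x₂ x₃ y₁ y₂ y₃ : ℝ) :
    ⟪x₁ • e 0 + x₂ • e 1 + x₃ • e 2, y₁ • e 0 + y₂ • e 1 + y₃ • e 2⟫ =
      x₁ * y₁ + x₂ * y₂ + x₃ * y₃ := by
  simpa [Fin.sum_univ_three] using he.inner_sum ![x₁, x₂, x₃] ![y₁, y₂, y₃] Finset.univ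

/-- An orthonormal triple spans a three-dimensional space. -/
theorem Orthonormal.exists_eq_combination_three {V : Type*} [NormedAddCommGroup V]
    [InnerProductSpace ℝ V] (hdim : Module.finrank ℝ V = 3) {e : Fin 3 → V}
    (he : Orthonormal ℝ e) (X : V) :
    ∃ x₁ x₂ x₃ : ℝ, X = x₁ • e 0 + x₂ • e 1 + x₃ • e 2 := by
  let b := basisOfLinearIndependentOfCardEqFinrank he.linearIndependent (by simp [hdim])
  refine ⟨b.repr X 0, b.repr X 1, b.repr X 2, ?_⟩
  simpa [b, Fin.sum_univ_three] using (b.sum_repr X).symm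

/-- In the generic case `λ < ε < Λ`, a 2-plane `σ` with unit normal `u = c₁e₁ + c₂e₂ + c₃e₃`
has `sec(σ) = ε` if and only if `c₁ = ±m·c₂`, where `m = √((ε−λ)/(Λ−ε))`. -/
theorem sec_eq_eps_iff_generic
    {V : Type*} [NormedAddCommGroup V] [InnerProductSpace ℝ V]
    (hdim : Module.finrank ℝ V = 3)
    (R : V →ₗ[ℝ] V →ₗ[ℝ] V →ₗ[ℝ] V →ₗ[ℝ] ℝ) (hR : IsAlgCurvatureTensor R)
    (e : Fin 3 → V) (he : Orthonormal ℝ e)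
    (ε : ℝ) (hε : ε = -1 ∨ ε = 0 ∨ ε = 1)
    (hd1 : R (e 0) (e 1) (e 2) (e 0) = 0)
    (hd2 : R (e 0) (e 1) (e 1) (e 2) = 0)
    (hd3 : R (e 0) (e 2) (e 2) (e 1) = 0)
    (lam Lam : ℝ)
    (hlam : lam = R (e 0) (e 2) (e 2) (e 0))
    (hLam : Lam = R (e 1) (e 2) (e 2) (e 1))
    (h12 : R (e 0) (e 1) (e 1) (e 0) = ε)
    (horder : lam ≤ ε ∧ ε ≤ Lam)
    (hgen : lam < ε ∧ ε < Lam)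
    (m : ℝ) (hm : m = Real.sqrt ((ε - lam) / (Lam - ε)))
    (c₁ c₂ c₃ : ℝ) (u X Y : V)
    (hu : u = c₁ • e 0 + c₂ • e 1 + c₃ • e 2) (hunorm : ‖u‖ = 1)
    (hXnorm : ‖X‖ = 1) (hYnorm : ‖Y‖ = 1) (hXY : ⟪X, Y⟫ = 0)
    (hXu : ⟪X, u⟫ = 0) (hYu : ⟪Y, u⟫ = 0)
    :
    R X Y Y X = ε ↔ (c₁ = m * c₂ ∨ c₁ = -(m * c₂)) := by
  obtain ⟨x₁, x₂, x₃, hX⟩ := he.exists_eq_combination_three hdim X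
  obtain ⟨y₁, y₂, y₃, hY⟩ := he.exists_eq_combination_three hdim Y
  have hXX : ⟪X, X⟫ = 1 := by rw [real_inner_self_eq_norm_sq, hXnorm, one_pow]
  have hYY : ⟪Y, Y⟫ = 1 := by rw [real_inner_self_eq_norm_sq, hYnorm, one_pow]
  have huu : ⟪u, u⟫ = 1 := by rw [real_inner_self_eq_norm_sq, hunorm, one_pow]
  rw [hX, he.inner_combination_three] at hXX
  rw [hY, he.inner_combination_three] at hYY
  rw [hu, he.inner_combination_three] at huu
  rw [hX, hY, he.inner_combination_three] at hXY
  rw [hX, hu, he.inner_combination_three] at hXu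
  rw [hY, hu, he.inner_combination_three] at hYu
  obtain ⟨h₃, h₂, h₁⟩ := sq_minor_eq_sq_of_orthonormal_rows_s4 (by linarith) (by linarith)
    (by linarith) hXY hXu hYu
  have hpos : 0 < Lam - ε := sub_pos.mpr hgen.2
  have hmsq : (Lam - ε) * m ^ 2 = ε - lam := by
    rw [hm, Real.sq_sqrt (div_nonneg (sub_nonneg.mpr horder.1) hpos.le)]
    field_simp
  have hsec : R X Y Y X - ε = (Lam - ε) * (c₁ ^ 2 - (m * c₂) ^ 2) := by
    rw [hR.apply_of_diagonal hd1 hd2 hd3 x₁ x₂ x₃ y₁ y₂ y₃ hX hY, h₁, h₂, h₃, h12, ← hlam,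
      ← hLam]
    linear_combination ε * huu + c₂ ^ 2 * hmsq
  rw [← sub_eq_zero, hsec, mul_eq_zero_iff_left hpos.ne', sub_eq_zero, sq_eq_sq_iff_eq_or_eq_neg]
end

section
/- Let X = (x₁, x₂, x₃) ∈ V be a unit vector, and assume (λ, Λ) ≠ (ε, ε). Then: (1) if λ = ε < Λ, X is isocurved if and only if x₁ = ±1; (2) if λ < ε = Λ, X is isocurved if and only if x₂ = ±1; (3) if λ < ε < Λ, X is isocurved if and only if x₃ = 0 and x₂ = ±m·x₁, where m = √((ε−λ)/(Λ−ε)). -/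
open scoped RealInnerProductSpace

namespace IsAlgCurvatureTensor

variable {V : Type*} [NormedAddCommGroup V] [InnerProductSpace ℝ V]
  {R : V →ₗ[ℝ] V →ₗ[ℝ] V →ₗ[ℝ] V →ₗ[ℝ] ℝ}

lemma self_fst (hR : IsAlgCurvatureTensor R) (X Z W : V) : R X X Z W = 0 := by
  linarith [hR.antisym_fst X X Z W]

lemma self_snd (hR : IsAlgCurvatureTensor R) (X Y Z : V) : R X Y Z Z = 0 := by
  linarith [hR.antisym_snd X Y Z Z]

/-- A curvature tensor that is diagonal in the frame `e` is a combination of squares of the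
coordinates of the cross product of its arguments. -/
lemma apply_of_diagonal_s5 (hR : IsAlgCurvatureTensor R) (e : Fin 3 → V)
    (hd1 : R (e 0) (e 1) (e 2) (e 0) = 0) (hd2 : R (e 0) (e 1) (e 1) (e 2) = 0)
    (hd3 : R (e 0) (e 2) (e 2) (e 1) = 0) (x y z a b c : ℝ) :
    R (x • e 0 + y • e 1 + z • e 2) (a • e 0 + b • e 1 + c • e 2)
        (a • e 0 + b • e 1 + c • e 2) (x • e 0 + y • e 1 + z • e 2) =
      R (e 0) (e 1) (e 1) (e 0) * (x * b - y * a) ^ 2 +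
      R (e 0) (e 2) (e 2) (e 0) * (x * c - z * a) ^ 2 +
      R (e 1) (e 2) (e 2) (e 1) * (y * c - z * b) ^ 2 := by
  have swap10 := hR.antisym_fst (e 1) (e 0)
  have swap20 := hR.antisym_fst (e 2) (e 0)
  have swap21 := hR.antisym_fst (e 2) (e 1)
  have swap01 := fun X Y => hR.antisym_snd X Y (e 0) (e 1)
  have swap02 := fun X Y => hR.antisym_snd X Y (e 0) (e 2)
  have swap12 := fun X Y => hR.antisym_snd X Y (e 1) (e 2)
  have h0121 : R (e 0) (e 1) (e 2) (e 1) = 0 := by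
    linarith [hR.antisym_snd (e 0) (e 1) (e 1) (e 2)]
  have h0210 : R (e 0) (e 2) (e 1) (e 0) = 0 := by
    linarith [hR.pair_symm (e 0) (e 2) (e 1) (e 0), swap10 (e 0) (e 2), swap02 (e 0) (e 1)]
  have h1210 : R (e 1) (e 2) (e 1) (e 0) = 0 := by
    linarith [hR.pair_symm (e 1) (e 2) (e 1) (e 0), swap10 (e 1) (e 2)]
  have h1220 : R (e 1) (e 2) (e 2) (e 0) = 0 := by
    linarith [hR.pair_symm (e 1) (e 2) (e 2) (e 0), swap20 (e 1) (e 2), swap12 (e 0) (e 2)]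
  simp only [map_add, map_smul, LinearMap.add_apply, LinearMap.smul_apply, smul_eq_mul,
    hR.self_fst, hR.self_snd, swap10, swap20, swap21, swap01, swap02, swap12, hd1, hd3, h0121,
    h0210, h1210, h1220]
  ring

/-- If every plane containing the unit vector `X` has curvature `ε`, then the homogenized
identity holds for every vector. -/
lemma apply_of_isocurved (hR : IsAlgCurvatureTensor R) {ε : ℝ} {X : V} (hX : ‖X‖ = 1)
    (h : ∀ W : V, ‖W‖ = 1 → ⟪X, W⟫ = 0 → R X W W X = ε) (W : V) :
    R X W W X = ε * (⟪W, W⟫ - ⟪X, W⟫ ^ 2) := by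
  set Y := W - ⟪X, W⟫ • X with hY
  have hXX : ⟪X, X⟫ = 1 := by rw [real_inner_self_eq_norm_sq, hX, one_pow]
  have hXY : ⟪X, Y⟫ = 0 := by
    rw [hY, inner_sub_right, real_inner_smul_right, hXX]; ring
  have hYY : ⟪Y, Y⟫ = ⟪W, W⟫ - ⟪X, W⟫ ^ 2 := by
    simp only [hY, inner_sub_left, inner_sub_right, real_inner_smul_left, real_inner_smul_right,
      hXX, real_inner_comm X W]
    ring
  have hRY : R X W W X = R X Y Y X := by
    simp [hY, hR.self_fst, hR.self_snd]
  rw [← hYY, hRY]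
  rcases eq_or_ne Y 0 with h0 | h0
  · simp [h0]
  have hn : ‖Y‖ ≠ 0 := norm_ne_zero_iff.mpr h0
  have key := h (‖Y‖⁻¹ • Y) (norm_smul_inv_norm h0) (by rw [real_inner_smul_right, hXY, mul_zero])
  simp only [map_smul, LinearMap.smul_apply, smul_eq_mul] at key
  rw [real_inner_self_eq_norm_sq, ← key]
  field_simp

end IsAlgCurvatureTensor

lemma Orthonormal.inner_fin_three {V : Type*} [NormedAddCommGroup V] [InnerProductSpace ℝ V]
    {e : Fin 3 → V} (he : Orthonormal ℝ e) (x y z a b c : ℝ) :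
    ⟪x • e 0 + y • e 1 + z • e 2, a • e 0 + b • e 1 + c • e 2⟫ = x * a + y * b + z * c := by
  have h := orthonormal_iff_ite.mp he
  simp [inner_add_left, inner_add_right, real_inner_smul_left, real_inner_smul_right, h,
    -inner_self_eq_norm_sq_to_K]
  ring

lemma Orthonormal.exists_coord_fin_three {V : Type*} [NormedAddCommGroup V]
    [InnerProductSpace ℝ V] (hdim : Module.finrank ℝ V = 3) {e : Fin 3 → V}
    (he : Orthonormal ℝ e) (W : V) : ∃ a b c : ℝ, W = a • e 0 + b • e 1 + c • e 2 := by
  let B := basisOfLinearIndependentOfCardEqFinrank he.linearIndependent (by simp [hdim])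
  refine ⟨B.repr W 0, B.repr W 1, B.repr W 2, ?_⟩
  conv_lhs => rw [← B.sum_repr W]
  simp [B, Fin.sum_univ_three]

/-- For a diagonal curvature tensor which is not isotropic, `X` is isocurved exactly when it
lies in the plane of `e 0`, `e 1` and on the cone `(Lam - ε) y ^ 2 = (ε - lam) x ^ 2`. -/
lemma isocurved_iff_coord {V : Type*} [NormedAddCommGroup V] [InnerProductSpace ℝ V]
    (hdim : Module.finrank ℝ V = 3)
    {R : V →ₗ[ℝ] V →ₗ[ℝ] V →ₗ[ℝ] V →ₗ[ℝ] ℝ} (hR : IsAlgCurvatureTensor R)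
    {e : Fin 3 → V} (he : Orthonormal ℝ e) {ε lam Lam : ℝ}
    (hd1 : R (e 0) (e 1) (e 2) (e 0) = 0) (hd2 : R (e 0) (e 1) (e 1) (e 2) = 0)
    (hd3 : R (e 0) (e 2) (e 2) (e 1) = 0)
    (hlam : lam = R (e 0) (e 2) (e 2) (e 0)) (hLam : Lam = R (e 1) (e 2) (e 2) (e 1))
    (h12 : R (e 0) (e 1) (e 1) (e 0) = ε) (hne : ¬ (lam = ε ∧ Lam = ε))
    {x y z : ℝ} {X : V} (hX : X = x • e 0 + y • e 1 + z • e 2) (hsq : x ^ 2 + y ^ 2 + z ^ 2 = 1) :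
    (∀ W : V, ‖W‖ = 1 → ⟪X, W⟫ = 0 → R X W W X = ε) ↔
      z = 0 ∧ (Lam - ε) * y ^ 2 = (ε - lam) * x ^ 2 := by
  have hnorm : ‖X‖ = 1 := by
    have h : ‖X‖ ^ 2 = 1 := by
      rw [← real_inner_self_eq_norm_sq, hX, he.inner_fin_three]; linarith
    exact (pow_eq_one_iff_of_nonneg (norm_nonneg X) two_ne_zero).mp h
  have hcurv := hR.apply_of_diagonal_s5 e hd1 hd2 hd3 x y z
  simp only [← hX, h12, ← hlam, ← hLam] at hcurv
  have hin := he.inner_fin_three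
  constructor
  · intro h
    have key : ∀ a b c : ℝ,
        (Lam - ε) * (y * c - z * b) ^ 2 = (ε - lam) * (x * c - z * a) ^ 2 := by
      intro a b c
      have hW := hR.apply_of_isocurved hnorm h (a • e 0 + b • e 1 + c • e 2)
      rw [hcurv, hin, hX, hin] at hW
      linear_combination hW - ε * (a ^ 2 + b ^ 2 + c ^ 2) * hsq
    refine ⟨?_, by simpa using key 0 0 1⟩
    by_contra hz
    have h0 := key 1 0 0
    have h1 := key 0 1 0
    simp [hz, sub_eq_zero] at h0 h1
    exact hne ⟨h0.symm, h1⟩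
  · rintro ⟨rfl, hcone⟩ W hW hXW
    obtain ⟨a, b, c, rfl⟩ := he.exists_coord_fin_three hdim W
    have hWsq := real_inner_self_eq_norm_sq (a • e 0 + b • e 1 + c • e 2)
    rw [hW, hin] at hWsq
    rw [hX, hin] at hXW
    rw [hcurv]
    linear_combination c ^ 2 * hcone + ε * (a ^ 2 + b ^ 2 + c ^ 2) * hsq + ε * hWsq -
      ε * (x * a + y * b) * hXW

/-- Characterization of isocurved unit vectors (unit vectors `X` such that every 2-plane
containing `X` has sectional curvature `ε`), in each of the three non-isotropic cases. -/
theorem isocurved_iff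
    {V : Type*} [NormedAddCommGroup V] [InnerProductSpace ℝ V]
    (hdim : Module.finrank ℝ V = 3)
    (R : V →ₗ[ℝ] V →ₗ[ℝ] V →ₗ[ℝ] V →ₗ[ℝ] ℝ) (hR : IsAlgCurvatureTensor R)
    (e : Fin 3 → V) (he : Orthonormal ℝ e)
    (ε : ℝ) (hε : ε = -1 ∨ ε = 0 ∨ ε = 1)
    (hd1 : R (e 0) (e 1) (e 2) (e 0) = 0)
    (hd2 : R (e 0) (e 1) (e 1) (e 2) = 0)
    (hd3 : R (e 0) (e 2) (e 2) (e 1) = 0)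
    (lam Lam : ℝ)
    (hlam : lam = R (e 0) (e 2) (e 2) (e 0))
    (hLam : Lam = R (e 1) (e 2) (e 2) (e 1))
    (h12 : R (e 0) (e 1) (e 1) (e 0) = ε)
    (horder : lam ≤ ε ∧ ε ≤ Lam)
    (hne : ¬ (lam = ε ∧ Lam = ε))
    (x₁ x₂ x₃ : ℝ) (X : V)
    (hX : X = x₁ • e 0 + x₂ • e 1 + x₃ • e 2) (hXnorm : ‖X‖ = 1) :
    (lam = ε ∧ ε < Lam →
      ((∀ W : V, ‖W‖ = 1 → ⟪X, W⟫ = 0 → R X W W X = ε) ↔ (x₁ = 1 ∨ x₁ = -1))) ∧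
    (lam < ε ∧ ε = Lam →
      ((∀ W : V, ‖W‖ = 1 → ⟪X, W⟫ = 0 → R X W W X = ε) ↔ (x₂ = 1 ∨ x₂ = -1))) ∧
    (lam < ε ∧ ε < Lam →
      ((∀ W : V, ‖W‖ = 1 → ⟪X, W⟫ = 0 → R X W W X = ε) ↔
        (x₃ = 0 ∧ (x₂ = Real.sqrt ((ε - lam) / (Lam - ε)) * x₁ ∨
          x₂ = -(Real.sqrt ((ε - lam) / (Lam - ε)) * x₁))))) := by
  have hsq : x₁ ^ 2 + x₂ ^ 2 + x₃ ^ 2 = 1 := by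
    have h := real_inner_self_eq_norm_sq X
    rw [hXnorm, hX, he.inner_fin_three] at h
    linarith
  rw [isocurved_iff_coord hdim hR he hd1 hd2 hd3 hlam hLam h12 hne hX hsq]
  refine ⟨?_, ?_, ?_⟩
  · rintro ⟨rfl, hlt⟩
    rw [← sq_eq_one_iff, sub_self, zero_mul, mul_eq_zero_iff_left (sub_pos.mpr hlt).ne']
    constructor
    · rintro ⟨rfl, h⟩
      linarith
    · intro h
      exact ⟨pow_eq_zero_iff two_ne_zero |>.mp (by nlinarith), by nlinarith⟩
  · rintro ⟨hlt, rfl⟩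
    rw [← sq_eq_one_iff, sub_self, zero_mul, eq_comm (a := (0 : ℝ)),
      mul_eq_zero_iff_left (sub_pos.mpr hlt).ne']
    constructor
    · rintro ⟨rfl, h⟩
      linarith
    · intro h
      exact ⟨pow_eq_zero_iff two_ne_zero |>.mp (by nlinarith), by nlinarith⟩
  · rintro ⟨hlt, hlt'⟩
    have hb := (sub_pos.mpr hlt').ne'
    rw [← sq_eq_sq_iff_eq_or_eq_neg, mul_pow,
      Real.sq_sqrt (div_nonneg (sub_nonneg.mpr hlt.le) (sub_nonneg.mpr hlt'.le)),
      div_mul_eq_mul_div, eq_div_iff hb, mul_comm (x₂ ^ 2)]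
end

section
/- Let X = (x₁, x₂, x₃) ∈ V be a unit vector with x₃ ≠ 0, and let W be a unit vector orthogonal to X. Then V⁺ and V⁻ are linearly independent, and R(X, W, W, X) = ε if and only if W ∈ {V⁺, −V⁺, V⁻, −V⁻}. -/
open scoped RealInnerProductSpace

/-- In a basis diagonalizing the curvature operator, `R(X, W, W, X)` is the combination of the
squared Plücker coordinates of `X ∧ W` weighted by the coordinate sectional curvatures. -/
theorem IsAlgCurvatureTensor.apply_of_diagonal_s8
    {V : Type*} [NormedAddCommGroup V] [InnerProductSpace ℝ V]
    {R : V →ₗ[ℝ] V →ₗ[ℝ] V →ₗ[ℝ] V →ₗ[ℝ] ℝ} (hR : IsAlgCurvatureTensor R) (e : Fin 3 → V)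
    (hd1 : R (e 0) (e 1) (e 2) (e 0) = 0)
    (hd2 : R (e 0) (e 1) (e 1) (e 2) = 0)
    (hd3 : R (e 0) (e 2) (e 2) (e 1) = 0) (x₁ x₂ x₃ w₁ w₂ w₃ : ℝ) :
    R (x₁ • e 0 + x₂ • e 1 + x₃ • e 2) (w₁ • e 0 + w₂ • e 1 + w₃ • e 2)
      (w₁ • e 0 + w₂ • e 1 + w₃ • e 2) (x₁ • e 0 + x₂ • e 1 + x₃ • e 2) =
    R (e 0) (e 1) (e 1) (e 0) * (x₁ * w₂ - x₂ * w₁) ^ 2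
      + R (e 0) (e 2) (e 2) (e 0) * (x₁ * w₃ - x₃ * w₁) ^ 2
      + R (e 1) (e 2) (e 2) (e 1) * (x₂ * w₃ - x₃ * w₂) ^ 2 := by
  have self_fst (a b c : V) : R a a b c = 0 := by linarith [hR.antisym_fst a a b c]
  have self_snd (a b c : V) : R a b c c = 0 := by linarith [hR.antisym_snd a b c c]
  have h10 := hR.antisym_fst (e 1) (e 0)
  have h20 := hR.antisym_fst (e 2) (e 0)
  have h21 := hR.antisym_fst (e 2) (e 1)
  have k01 (a b : V) := hR.antisym_snd a b (e 0) (e 1)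
  have k02 (a b : V) := hR.antisym_snd a b (e 0) (e 2)
  have k12 (a b : V) := hR.antisym_snd a b (e 1) (e 2)
  have hd1' : R (e 0) (e 2) (e 1) (e 0) = 0 := by
    rw [hR.pair_symm, h10, k02, hd1]; simp
  have hd2' : R (e 1) (e 2) (e 1) (e 0) = 0 := by
    rw [hR.pair_symm, h10, hd2]; simp
  have hd2'' : R (e 0) (e 1) (e 2) (e 1) = 0 := by
    rw [← neg_eq_zero, ← k12, hd2]
  have hd3' : R (e 1) (e 2) (e 2) (e 0) = 0 := by
    rw [hR.pair_symm, h20, k12, hd3]; simp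
  simp only [map_add, map_smul, LinearMap.add_apply, LinearMap.smul_apply, smul_eq_mul,
    self_fst, self_snd, h10, h20, h21, k01, k02, k12, hd1, hd1', hd2', hd2'', hd3, hd3']
  ring

/-- The inner product of two vectors in coordinates with respect to an orthonormal triple. -/
theorem Orthonormal.inner_fin_three_s8
    {V : Type*} [NormedAddCommGroup V] [InnerProductSpace ℝ V]
    {e : Fin 3 → V} (he : Orthonormal ℝ e) (x₁ x₂ x₃ w₁ w₂ w₃ : ℝ) :
    ⟪x₁ • e 0 + x₂ • e 1 + x₃ • e 2, w₁ • e 0 + w₂ • e 1 + w₃ • e 2⟫ =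
      x₁ * w₁ + x₂ * w₂ + x₃ * w₃ := by
  have h := he.inner_sum ![x₁, x₂, x₃] ![w₁, w₂, w₃] Finset.univ
  simpa [Fin.sum_univ_three] using h

/-- Vectors with given coordinates in an orthonormal triple agree iff the coordinates do. -/
theorem Orthonormal.eq_iff_fin_three
    {V : Type*} [NormedAddCommGroup V] [InnerProductSpace ℝ V]
    {e : Fin 3 → V} (he : Orthonormal ℝ e) (x₁ x₂ x₃ w₁ w₂ w₃ : ℝ) :
    x₁ • e 0 + x₂ • e 1 + x₃ • e 2 = w₁ • e 0 + w₂ • e 1 + w₃ • e 2 ↔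
      x₁ = w₁ ∧ x₂ = w₂ ∧ x₃ = w₃ := by
  refine ⟨fun h => ?_, by rintro ⟨rfl, rfl, rfl⟩; rfl⟩
  have key (a b c : ℝ) := congrArg (fun v => ⟪a • e 0 + b • e 1 + c • e 2, v⟫) h
  simp only [he.inner_fin_three_s8] at key
  exact ⟨by linarith [key 1 0 0], by linarith [key 0 1 0], by linarith [key 0 0 1]⟩

/-- A triple of orthonormal vectors in a three-dimensional space spans it. -/
theorem Orthonormal.exists_coords_fin_three
    {V : Type*} [NormedAddCommGroup V] [InnerProductSpace ℝ V]
    (hdim : Module.finrank ℝ V = 3) {e : Fin 3 → V} (he : Orthonormal ℝ e) (W : V) :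
    ∃ w₁ w₂ w₃ : ℝ, W = w₁ • e 0 + w₂ • e 1 + w₃ • e 2 := by
  let b := basisOfLinearIndependentOfCardEqFinrank he.linearIndependent (by simp [hdim])
  have h := b.sum_repr W
  rw [Fin.sum_univ_three] at h
  exact ⟨b.repr W 0, b.repr W 1, b.repr W 2, by
    simpa [b, coe_basisOfLinearIndependentOfCardEqFinrank] using h.symm⟩

/-- For orthonormal `X`, `W` in `ℝ³`, the vector `a = (1, -m, 0)` is coplanar with `X` and `W`
iff `W` is, up to sign, the normalized projection of `a` onto the orthogonal complement of `X`. -/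
theorem coplanar_iff_eq_normalized_projection
    {m x₁ x₂ x₃ w₁ w₂ w₃ K : ℝ} (hx : x₁ ^ 2 + x₂ ^ 2 + x₃ ^ 2 = 1)
    (hw : w₁ ^ 2 + w₂ ^ 2 + w₃ ^ 2 = 1) (hxw : x₁ * w₁ + x₂ * w₂ + x₃ * w₃ = 0)
    (hK : K ≠ 0) (hK2 : K ^ 2 = 1 + m ^ 2 - (m * x₂ - x₁) ^ 2) :
    (x₂ * w₃ - x₃ * w₂) + m * (x₁ * w₃ - x₃ * w₁) = 0 ↔
      (w₁ = 1 / K * (1 + m * x₁ * x₂ - x₁ ^ 2) ∧ w₂ = 1 / K * (m * x₂ ^ 2 - x₁ * x₂ - m) ∧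
        w₃ = 1 / K * ((m * x₂ - x₁) * x₃)) ∨
      (w₁ = -(1 / K * (1 + m * x₁ * x₂ - x₁ ^ 2)) ∧
        w₂ = -(1 / K * (m * x₂ ^ 2 - x₁ * x₂ - m)) ∧
        w₃ = -(1 / K * ((m * x₂ - x₁) * x₃))) := by
  constructor
  · intro h
    have hM : !![x₁, x₂, x₃; w₁, w₂, w₃; x₂ * w₃ - x₃ * w₂, x₃ * w₁ - x₁ * w₃, x₁ * w₂ - x₂ * w₁] *
        !![x₁, w₁, x₂ * w₃ - x₃ * w₂; x₂, w₂, x₃ * w₁ - x₁ * w₃; x₃, w₃, x₁ * w₂ - x₂ * w₁]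
        = 1 := by
      ext i j
      fin_cases i <;> fin_cases j <;> simp [Matrix.mul_apply, Fin.sum_univ_three] <;> grind
    have hM' := mul_eq_one_comm.mp hM
    have c (i j : Fin 3) := congrFun (congrFun hM' i) j
    have c00 := c 0 0
    have c01 := c 0 1
    have c11 := c 1 1
    have c20 := c 2 0
    have c21 := c 2 1
    simp [Matrix.mul_apply, Fin.sum_univ_three] at c00 c01 c11 c20 c21
    have u1 : 1 + m * x₁ * x₂ - x₁ ^ 2 = (w₁ - m * w₂) * w₁ := by
      linear_combination m * c01 - c00 + (x₂ * w₃ - x₃ * w₂) * h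
    have u2 : m * x₂ ^ 2 - x₁ * x₂ - m = (w₁ - m * w₂) * w₂ := by
      linear_combination m * c11 - c01 + (x₃ * w₁ - x₁ * w₃) * h
    have u3 : (m * x₂ - x₁) * x₃ = (w₁ - m * w₂) * w₃ := by
      linear_combination m * c21 - c20 + (x₁ * w₂ - x₂ * w₁) * h
    have hs : (w₁ - m * w₂) ^ 2 = K ^ 2 := by
      linear_combination -hK2 - u1 + m * u2
    rw [u1, u2, u3]
    rcases sq_eq_sq_iff_eq_or_eq_neg.mp hs with hs | hs <;> rw [hs]
    · left; refine ⟨?_, ?_, ?_⟩ <;> field_simp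
    · right; refine ⟨?_, ?_, ?_⟩ <;> field_simp
  · rintro (⟨h1, h2, h3⟩ | ⟨h1, h2, h3⟩) <;> rw [h1, h2, h3] <;> ring

/-- For a generic unit vector `X = (x₁, x₂, x₃)` (with `x₃ ≠ 0`) in the generic case,
`V⁺` and `V⁻` are linearly independent, and a unit vector `W ⊥ X` spans a curvature-`ε`
plane with `X` if and only if `W ∈ {V⁺, −V⁺, V⁻, −V⁻}`. -/
theorem curvature_eps_planes_generic
    {V : Type*} [NormedAddCommGroup V] [InnerProductSpace ℝ V]
    (hdim : Module.finrank ℝ V = 3)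
    (R : V →ₗ[ℝ] V →ₗ[ℝ] V →ₗ[ℝ] V →ₗ[ℝ] ℝ) (hR : IsAlgCurvatureTensor R)
    (e : Fin 3 → V) (he : Orthonormal ℝ e)
    (ε : ℝ) (hε : ε = -1 ∨ ε = 0 ∨ ε = 1)
    (hd1 : R (e 0) (e 1) (e 2) (e 0) = 0)
    (hd2 : R (e 0) (e 1) (e 1) (e 2) = 0)
    (hd3 : R (e 0) (e 2) (e 2) (e 1) = 0)
    (lam Lam : ℝ)
    (hlam : lam = R (e 0) (e 2) (e 2) (e 0))
    (hLam : Lam = R (e 1) (e 2) (e 2) (e 1))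
    (h12 : R (e 0) (e 1) (e 1) (e 0) = ε)
    (horder : lam ≤ ε ∧ ε ≤ Lam)
    (hgen : lam < ε ∧ ε < Lam)
    (m : ℝ) (hm : m = Real.sqrt ((ε - lam) / (Lam - ε)))
    (x₁ x₂ x₃ : ℝ) (X : V)
    (hX : X = x₁ • e 0 + x₂ • e 1 + x₃ • e 2) (hXnorm : ‖X‖ = 1)
    (hx₃ : x₃ ≠ 0)
    (K L : ℝ)
    (hK : K = Real.sqrt (1 + m ^ 2 - (m * x₂ - x₁) ^ 2))
    (hL : L = Real.sqrt (1 + m ^ 2 - (m * x₂ + x₁) ^ 2))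
    (Vp Vm : V)
    (hVp : Vp = (1 / K) • ((1 + m * x₁ * x₂ - x₁ ^ 2) • e 0
      + (m * x₂ ^ 2 - x₁ * x₂ - m) • e 1 + ((m * x₂ - x₁) * x₃) • e 2))
    (hVm : Vm = (1 / L) • ((1 - m * x₁ * x₂ - x₁ ^ 2) • e 0
      + (-(m * x₂ ^ 2) - x₁ * x₂ + m) • e 1 + ((-(m * x₂) - x₁) * x₃) • e 2))
    (W : V) (hWnorm : ‖W‖ = 1) (hWX : ⟪X, W⟫ = 0) :
    LinearIndependent ℝ ![Vp, Vm] ∧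
      (R X W W X = ε ↔ (W = Vp ∨ W = -Vp ∨ W = Vm ∨ W = -Vm)) := by
  obtain ⟨w₁, w₂, w₃, rfl⟩ := he.exists_coords_fin_three hdim W
  have hx : x₁ ^ 2 + x₂ ^ 2 + x₃ ^ 2 = 1 := by
    have h := real_inner_self_eq_norm_sq X
    rw [hXnorm, hX, he.inner_fin_three_s8] at h
    linarith
  have hw : w₁ ^ 2 + w₂ ^ 2 + w₃ ^ 2 = 1 := by
    have h := real_inner_self_eq_norm_sq (w₁ • e 0 + w₂ • e 1 + w₃ • e 2)
    rw [hWnorm, he.inner_fin_three_s8] at h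
    linarith
  have hxw : x₁ * w₁ + x₂ * w₂ + x₃ * w₃ = 0 := by
    rw [hX, he.inner_fin_three_s8] at hWX
    exact hWX
  have hLe : 0 < Lam - ε := sub_pos.mpr hgen.2
  have hmpos : 0 < m := by
    rw [hm]
    exact Real.sqrt_pos.mpr (div_pos (sub_pos.mpr hgen.1) hLe)
  have hm2 : m ^ 2 * (Lam - ε) = ε - lam := by
    rw [hm, Real.sq_sqrt (div_pos (sub_pos.mpr hgen.1) hLe).le, div_mul_cancel₀ _ hLe.ne']
  have hx₃sq : 0 < x₃ ^ 2 := by positivity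
  have hKpos : 0 < 1 + m ^ 2 - (m * x₂ - x₁) ^ 2 := by
    have : 1 + m ^ 2 - (m * x₂ - x₁) ^ 2 = x₃ ^ 2 + (m * x₃) ^ 2 + (x₂ + m * x₁) ^ 2 := by
      linear_combination -(1 + m ^ 2) * hx
    rw [this]; positivity
  have hLpos : 0 < 1 + m ^ 2 - (m * x₂ + x₁) ^ 2 := by
    have : 1 + m ^ 2 - (m * x₂ + x₁) ^ 2 = x₃ ^ 2 + (m * x₃) ^ 2 + (x₂ - m * x₁) ^ 2 := by
      linear_combination -(1 + m ^ 2) * hx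
    rw [this]; positivity
  have hK0 : K ≠ 0 := hK ▸ (Real.sqrt_pos.mpr hKpos).ne'
  have hL0 : L ≠ 0 := hL ▸ (Real.sqrt_pos.mpr hLpos).ne'
  have hK2 : K ^ 2 = 1 + m ^ 2 - (m * x₂ - x₁) ^ 2 := by rw [hK, Real.sq_sqrt hKpos.le]
  have hL2 : L ^ 2 = 1 + (-m) ^ 2 - (-m * x₂ - x₁) ^ 2 := by
    rw [hL, Real.sq_sqrt hLpos.le]; ring
  rw [smul_add, smul_add, smul_smul, smul_smul, smul_smul] at hVp hVm
  constructor
  · rw [LinearIndependent.pair_iff]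
    intro s t hst
    have hcoord : (s * (1 / K) * (1 + m * x₁ * x₂ - x₁ ^ 2)
          + t * (1 / L) * (1 - m * x₁ * x₂ - x₁ ^ 2)) • e 0
        + (s * (1 / K) * (m * x₂ ^ 2 - x₁ * x₂ - m)
          + t * (1 / L) * (-(m * x₂ ^ 2) - x₁ * x₂ + m)) • e 1
        + (s * (1 / K) * ((m * x₂ - x₁) * x₃)
          + t * (1 / L) * ((-(m * x₂) - x₁) * x₃)) • e 2
        = (0 : ℝ) • e 0 + (0 : ℝ) • e 1 + (0 : ℝ) • e 2 := by
      rw [hVp, hVm] at hst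
      simp only [zero_smul, add_zero]
      rw [← hst]
      module
    obtain ⟨h1, h2, h3⟩ := (he.eq_iff_fin_three ..).mp hcoord
    set α := s * (1 / K) with hα
    set β := t * (1 / L) with hβ
    have hc : α * (m * x₂ - x₁) + β * (-(m * x₂) - x₁) = 0 :=
      mul_right_cancel₀ hx₃ (by linear_combination h3)
    have hsum : α + β = 0 := by linear_combination h1 - x₁ * hc
    have hdiff : β - α = 0 :=
      mul_left_cancel₀ hmpos.ne' (by linear_combination h2 - x₂ * hc)
    have hα0 : α = 0 := by linarith
    have hβ0 : β = 0 := by linarith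
    constructor
    · simpa [hK0] using hα.symm.trans hα0
    · simpa [hL0] using hβ.symm.trans hβ0
  · have hp := coplanar_iff_eq_normalized_projection hx hw hxw hK0 hK2
    have hq := coplanar_iff_eq_normalized_projection hx hw hxw hL0 hL2
    have hR' : R X (w₁ • e 0 + w₂ • e 1 + w₃ • e 2) (w₁ • e 0 + w₂ • e 1 + w₃ • e 2) X = ε ↔
        (x₂ * w₃ - x₃ * w₂) + m * (x₁ * w₃ - x₃ * w₁) = 0 ∨
        (x₂ * w₃ - x₃ * w₂) + -m * (x₁ * w₃ - x₃ * w₁) = 0 := by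
      rw [hX, hR.apply_of_diagonal_s8 e hd1 hd2 hd3, h12, ← hlam, ← hLam, ← mul_eq_zero,
        ← sub_eq_zero, ← mul_eq_zero_iff_left (b := _ * _) hLe.ne']
      have lagrange : (x₁ * w₂ - x₂ * w₁) ^ 2 + (x₁ * w₃ - x₃ * w₁) ^ 2
          + (x₂ * w₃ - x₃ * w₂) ^ 2 = 1 := by
        linear_combination (w₁ ^ 2 + w₂ ^ 2 + w₃ ^ 2) * hx + hw
          - (x₁ * w₁ + x₂ * w₂ + x₃ * w₃) * hxw
      apply Eq.congr_left
      linear_combination ε * lagrange + (x₁ * w₃ - x₃ * w₁) ^ 2 * hm2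
    have hneg (a b c : ℝ) : -(a • e 0 + b • e 1 + c • e 2) =
        (-a) • e 0 + (-b) • e 1 + (-c) • e 2 := by module
    rw [hR', hp, hq, hVp, hVm, hneg, hneg]
    simp only [he.eq_iff_fin_three, or_assoc, neg_mul, ← sub_eq_add_neg, sub_neg_eq_add]
end

section
/- Let m ≠ 0 and let Γ₁₁³, Γ₁₂³, Γ₂₁³, Γ₂₂³, Γ₃₁², Γ₁₁², Γ₂₂¹, Γ₃₃¹, Γ₃₃², μ₁, μ₂, μ₃ be real numbers with Γ₁₁³ = m²·Γ₂₂³. Suppose that (m·Γ₁₁³ − m²·Γ₁₂³)x₁² + (Γ₂₁³ − m·Γ₂₂³)x₂² + (μ₃ − (1+m²)·Γ₃₁²)x₃² + (Γ₁₁³ − m·Γ₁₂³ + m·Γ₂₁³ − m²·Γ₂₂³)x₁x₂ + (μ₁ − (1+m²)·Γ₁₁² − m·Γ₃₃¹ + m²·Γ₃₃²)x₁x₃ + (μ₂ + (1+m²)·Γ₂₂¹ − Γ₃₃¹ + m·Γ₃₃²)x₂x₃ = 0 for all (x₁, x₂, x₃) in some nonempty open subset of the unit sphere of ℝ³. Then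 Γ₁₁³ = m·Γ₁₂³ = m·Γ₂₁³ = m²·Γ₂₂³, μ₁ = (1+m²)·Γ₁₁² + m·Γ₃₃¹ − m²·Γ₃₃², μ₂ = −(1+m²)·Γ₂₂¹ + Γ₃₃¹ − m·Γ₃₃², and μ₃ = (1+m²)·Γ₃₁². -/
open Filter Topology

/-- A quadratic form on a real normed space that vanishes near some point is zero. -/
theorem QuadraticMap.eq_zero_of_eventually_eq_zero {E : Type*} [NormedAddCommGroup E]
    [NormedSpace ℝ E] (Q : QuadraticForm ℝ E) {p : E} (hQ : ∀ᶠ y in 𝓝 p, Q y = 0) : Q = 0 := by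
  ext v
  have hline (w : E) : ∀ᶠ t in 𝓝[≠] (0 : ℝ), Q (p + t • w) = 0 := by
    have hc : Tendsto (fun t : ℝ ↦ p + t • w) (𝓝 0) (𝓝 p) := by
      have : Continuous fun t : ℝ ↦ p + t • w := by fun_prop
      simpa using this.tendsto 0
    exact (hc.eventually hQ).filter_mono nhdsWithin_le_nhds
  obtain ⟨t, ⟨hpos, hneg⟩, ht⟩ :=
    (((hline v).and (hline (-v))).and self_mem_nhdsWithin).exists
  have hp : Q p = 0 := hQ.self_of_nhds
  rw [QuadraticMap.map_add Q, hp, QuadraticMap.map_smul, QuadraticMap.polar_smul_right] at hpos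
  rw [QuadraticMap.map_add Q, hp, QuadraticMap.map_smul, QuadraticMap.polar_smul_right,
    QuadraticMap.polar_neg_right, QuadraticMap.map_neg] at hneg
  simp only [smul_eq_mul] at hpos hneg
  have hsum : t * t * Q v = 0 := by linarith
  simpa [show t ≠ 0 from ht] using hsum

/-- A quadratic form vanishing on a nonempty relatively open subset of the unit sphere is zero. -/
theorem QuadraticMap.eq_zero_of_eq_zero_on_open_inter_sphere {E : Type*} [NormedAddCommGroup E]
    [NormedSpace ℝ E] (Q : QuadraticForm ℝ E) {U : Set E} (hU : IsOpen U)
    (hne : (U ∩ Metric.sphere (0 : E) 1).Nonempty)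
    (hQ : ∀ x ∈ U ∩ Metric.sphere (0 : E) 1, Q x = 0) : Q = 0 := by
  obtain ⟨p, hpU, hp⟩ := hne
  have hp1 : ‖p‖ = 1 := by simpa using hp
  have hp0 : ‖p‖ ≠ 0 := by simp [hp1]
  have hc : Tendsto (fun y : E ↦ ‖y‖⁻¹ • y) (𝓝 p) (𝓝 p) := by
    have : ContinuousAt (fun y : E ↦ ‖y‖⁻¹ • y) p :=
      (continuousAt_id.norm.inv₀ hp0).smul continuousAt_id
    simpa [ContinuousAt, hp1] using this
  refine Q.eq_zero_of_eventually_eq_zero (p := p) ?_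
  filter_upwards [hc.eventually (hU.mem_nhds hpU), continuousAt_id.norm.eventually_ne hp0]
    with y hyU hy0
  have hy0 : ‖y‖ ≠ 0 := hy0
  have h := hQ (‖y‖⁻¹ • y) ⟨hyU, by simp [norm_smul, hy0]⟩
  rw [QuadraticMap.map_smul, smul_eq_mul] at h
  exact (mul_eq_zero.mp h).resolve_left (by simpa using hy0)

/-- The coefficients of a ternary quadratic form vanishing on a nonempty relatively open subset
of the unit sphere of `ℝ³` are all zero. -/
theorem ternary_coeffs_eq_zero_of_eq_zero_on_open_inter_sphere (a b c d e f : ℝ)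
    {U : Set (EuclideanSpace ℝ (Fin 3))} (hU : IsOpen U)
    (hne : (U ∩ Metric.sphere (0 : EuclideanSpace ℝ (Fin 3)) 1).Nonempty)
    (h : ∀ x ∈ U ∩ Metric.sphere (0 : EuclideanSpace ℝ (Fin 3)) 1,
      a * x 0 ^ 2 + b * x 1 ^ 2 + c * x 2 ^ 2 + d * x 0 * x 1 + e * x 0 * x 2
        + f * x 1 * x 2 = 0) :
    a = 0 ∧ b = 0 ∧ c = 0 ∧ d = 0 ∧ e = 0 ∧ f = 0 := by
  let π (i : Fin 3) : EuclideanSpace ℝ (Fin 3) →ₗ[ℝ] ℝ := (EuclideanSpace.proj i).toLinearMap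
  let M (i j : Fin 3) : QuadraticForm ℝ (EuclideanSpace ℝ (Fin 3)) :=
    QuadraticMap.linMulLin (π i) (π j)
  let Q := a • M 0 0 + b • M 1 1 + c • M 2 2 + d • M 0 1 + e • M 0 2 + f • M 1 2
  have hQ_apply (x : EuclideanSpace ℝ (Fin 3)) : Q x = a * x 0 ^ 2 + b * x 1 ^ 2 + c * x 2 ^ 2
      + d * x 0 * x 1 + e * x 0 * x 2 + f * x 1 * x 2 := by
    simp [Q, M, π]
    ring
  have hQ : Q = 0 := Q.eq_zero_of_eq_zero_on_open_inter_sphere hU hne fun x hx ↦ by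
    rw [hQ_apply, h x hx]
  have hval (r s t : ℝ) :
      a * r ^ 2 + b * s ^ 2 + c * t ^ 2 + d * r * s + e * r * t + f * s * t = 0 := by
    simpa [hQ] using (hQ_apply !₂[r, s, t]).symm
  have ha := hval 1 0 0
  have hb := hval 0 1 0
  have hc := hval 0 0 1
  have hd := hval 1 1 0
  have he := hval 1 0 1
  have hf := hval 0 1 1
  refine ⟨?_, ?_, ?_, ?_, ?_, ?_⟩ <;> linarith

/-- If the quadratic form built from the Christoffel symbols `Γᵢⱼᵏ` and the derivatives
`μᵢ = eᵢ(m)` vanishes on a nonempty open subset of the unit sphere of `ℝ³`, and the Bianchi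
relation `Γ₁₁³ = m²·Γ₂₂³` holds with `m ≠ 0`, then all the Christoffel-symbol relations of
the paper hold. -/
theorem christoffel_relations_of_vanishing_on_open
    (m : ℝ) (hm : m ≠ 0)
    (Γ113 Γ123 Γ213 Γ223 Γ312 Γ112 Γ221 Γ331 Γ332 μ1 μ2 μ3 : ℝ)
    (hBianchi : Γ113 = m ^ 2 * Γ223)
    (U : Set (EuclideanSpace ℝ (Fin 3))) (hU : IsOpen U)
    (hne : (U ∩ Metric.sphere (0 : EuclideanSpace ℝ (Fin 3)) 1).Nonempty)
    (heq : ∀ x ∈ U ∩ Metric.sphere (0 : EuclideanSpace ℝ (Fin 3)) 1,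
      (m * Γ113 - m ^ 2 * Γ123) * (x 0) ^ 2
      + (Γ213 - m * Γ223) * (x 1) ^ 2
      + (μ3 - (1 + m ^ 2) * Γ312) * (x 2) ^ 2
      + (Γ113 - m * Γ123 + m * Γ213 - m ^ 2 * Γ223) * (x 0) * (x 1)
      + (μ1 - (1 + m ^ 2) * Γ112 - m * Γ331 + m ^ 2 * Γ332) * (x 0) * (x 2)
      + (μ2 + (1 + m ^ 2) * Γ221 - Γ331 + m * Γ332) * (x 1) * (x 2) = 0) :
    (Γ113 = m * Γ123 ∧ m * Γ123 = m * Γ213 ∧ m * Γ213 = m ^ 2 * Γ223) ∧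
    μ1 = (1 + m ^ 2) * Γ112 + m * Γ331 - m ^ 2 * Γ332 ∧
    μ2 = -(1 + m ^ 2) * Γ221 + Γ331 - m * Γ332 ∧
    μ3 = (1 + m ^ 2) * Γ312 := by
  obtain ⟨-, h22, h33, h12, h13, h23⟩ :=
    ternary_coeffs_eq_zero_of_eq_zero_on_open_inter_sphere _ _ _ _ _ _ hU hne heq
  have h213 : m * Γ213 = m ^ 2 * Γ223 := by linear_combination m * h22
  refine ⟨⟨?_, ?_, h213⟩, ?_, ?_, ?_⟩ <;> linarith
end

section
/- Let Γ₁₁², Γ₃₁², Γ₁₁³, Γ₂₁³, Γ₂₂¹, Γ₃₃¹ be real numbers, and suppose that x₃·(−x₁·Γ₁₁² + x₂·(Γ₂₂¹ − Γ₃₃¹) − x₃·Γ₃₁²) + x₂·(x₁·Γ₁₁³ + x₂·Γ₂₁³) = 0 for every unit vector (x₁, x₂, x₃) ∈ ℝ³ with x₁ ≠ 1 and x₁ ≠ −1. Then Γ₁₁² = Γ₁₁³ = Γ₂₁³ = Γ₃₁² = 0 and Γ₃₃¹ = Γ₂₂¹. -/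
/-- If the quadratic expression built from the Christoffel symbols vanishes for every unit
vector `(x₁, x₂, x₃)` of `ℝ³` with `x₁ ≠ ±1`, then `Γ₁₁² = Γ₁₁³ = Γ₂₁³ = Γ₃₁² = 0`
and `Γ₃₃¹ = Γ₂₂¹`. -/
theorem christoffel_relations_extremal
    (Γ112 Γ312 Γ113 Γ213 Γ221 Γ331 : ℝ)
    (heq : ∀ x₁ x₂ x₃ : ℝ, x₁ ^ 2 + x₂ ^ 2 + x₃ ^ 2 = 1 → x₁ ≠ 1 → x₁ ≠ -1 →
      x₃ * (-(x₁ * Γ112) + x₂ * (Γ221 - Γ331) - x₃ * Γ312)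
        + x₂ * (x₁ * Γ113 + x₂ * Γ213) = 0) :
    Γ112 = 0 ∧ Γ113 = 0 ∧ Γ213 = 0 ∧ Γ312 = 0 ∧ Γ331 = Γ221 := by
  have h2 := heq 0 1 0 (by norm_num) (by norm_num) (by norm_num)
  have h3 := heq 0 0 1 (by norm_num) (by norm_num) (by norm_num)
  have h23 := heq 0 (3 / 5) (4 / 5) (by norm_num) (by norm_num) (by norm_num)
  have h12 := heq (3 / 5) (4 / 5) 0 (by norm_num) (by norm_num) (by norm_num)
  have h13 := heq (3 / 5) 0 (4 / 5) (by norm_num) (by norm_num) (by norm_num)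
  refine ⟨?_, ?_, ?_, ?_, ?_⟩ <;> linarith
end

section
/- Define E₁ = (1/√(1+m²))·(e₁ − m·e₂), E₂ = (1/√(1+m²))·(m·e₁ + e₂), and E₃ = e₃. Then at least one of R(E₁, E₂, E₂, E₃) and R(E₁, E₃, E₃, E₂) is nonzero. -/
open scoped RealInnerProductSpace

/-- In the generic case, with `E₁ = (e₁ − m·e₂)/√(1+m²)`, `E₂ = (m·e₁ + e₂)/√(1+m²)`,
`E₃ = e₃`, at least one of `R(E₁,E₂,E₂,E₃)` and `R(E₁,E₃,E₃,E₂)` is nonzero. -/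
theorem mixed_curvature_nonzero
    {V : Type*} [NormedAddCommGroup V] [InnerProductSpace ℝ V]
    (hdim : Module.finrank ℝ V = 3)
    (R : V →ₗ[ℝ] V →ₗ[ℝ] V →ₗ[ℝ] V →ₗ[ℝ] ℝ) (hR : IsAlgCurvatureTensor R)
    (e : Fin 3 → V) (he : Orthonormal ℝ e)
    (ε : ℝ) (hε : ε = -1 ∨ ε = 0 ∨ ε = 1)
    (hd1 : R (e 0) (e 1) (e 2) (e 0) = 0)
    (hd2 : R (e 0) (e 1) (e 1) (e 2) = 0)
    (hd3 : R (e 0) (e 2) (e 2) (e 1) = 0)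
    (lam Lam : ℝ)
    (hlam : lam = R (e 0) (e 2) (e 2) (e 0))
    (hLam : Lam = R (e 1) (e 2) (e 2) (e 1))
    (h12 : R (e 0) (e 1) (e 1) (e 0) = ε)
    (horder : lam ≤ ε ∧ ε ≤ Lam)
    (hgen : lam < ε ∧ ε < Lam)
    (m : ℝ) (hm : m = Real.sqrt ((ε - lam) / (Lam - ε)))
    (E₁ E₂ E₃ : V)
    (hE₁ : E₁ = (1 / Real.sqrt (1 + m ^ 2)) • (e 0 - m • e 1))
    (hE₂ : E₂ = (1 / Real.sqrt (1 + m ^ 2)) • (m • e 0 + e 1))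
    (hE₃ : E₃ = e 2) :
    R E₁ E₂ E₂ E₃ ≠ 0 ∨ R E₁ E₃ E₃ E₂ ≠ 0 := by
  right
  have hd3' : R (e 1) (e 2) (e 2) (e 0) = 0 := by
    rw [hR.pair_symm, hR.antisym_fst, hR.antisym_snd, neg_neg, hd3]
  have hm0 : 0 < m := by
    rw [hm]
    exact Real.sqrt_pos.mpr (div_pos (sub_pos.mpr hgen.1) (sub_pos.mpr hgen.2))
  have hc : 0 < 1 / Real.sqrt (1 + m ^ 2) := by positivity
  have key : R E₁ E₃ E₃ E₂ = (1 / Real.sqrt (1 + m ^ 2)) ^ 2 * (m * (lam - Lam)) := by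
    rw [hE₁, hE₂, hE₃]
    simp only [sub_eq_add_neg (e 0), ← neg_smul, map_smul, map_add, LinearMap.smul_apply,
      LinearMap.add_apply, smul_eq_mul, hd3, hd3', ← hlam, ← hLam]
    ring
  rw [key]
  exact mul_ne_zero (pow_ne_zero 2 hc.ne')
    (mul_ne_zero hm0.ne' (sub_ne_zero.mpr (hgen.1.trans hgen.2).ne))
end

section
/- If y : ℝ → ℝ is differentiable and satisfies y′(t) = 2 − y(t)²/2 for all t ∈ ℝ, then −2 ≤ y(t) ≤ 2 for all t ∈ ℝ. -/
/-- A solution of `y′ = 2 − y²/2` which is below `-2` at time `a` stays below `-2` afterwards. -/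
lemma hyperbolic_riccati_lt_neg_two {y : ℝ → ℝ}
    (hy : ∀ t : ℝ, HasDerivAt y (2 - (y t) ^ 2 / 2) t) {a t : ℝ} (ha : y a < -2) (hat : a ≤ t) :
    y t < -2 := by
  have hd (s : ℝ) : HasDerivAt (fun s => (y s + 2) * Real.exp (-2 * s))
      (-((y s + 2) ^ 2 / 2 * Real.exp (-2 * s))) s := by
    have he : HasDerivAt (fun s : ℝ => Real.exp (-2 * s)) (Real.exp (-2 * s) * (-2 * 1)) s :=
      ((hasDerivAt_id s).const_mul (-2)).exp
    refine (((hy s).add_const 2).mul he).congr_deriv ?_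
    ring
  have hanti : Antitone fun s => (y s + 2) * Real.exp (-2 * s) :=
    antitone_of_deriv_nonpos (fun s => (hd s).differentiableAt) fun s => by
      rw [(hd s).deriv]
      exact neg_nonpos.mpr (by positivity)
  have hneg : (y t + 2) * Real.exp (-2 * t) < 0 :=
    (hanti hat).trans_lt (mul_neg_of_neg_of_pos (by linarith) (Real.exp_pos _))
  linarith [(neg_iff_pos_of_mul_neg hneg).mpr (Real.exp_pos _)]

/-- A global solution of `y′ = 2 − y²/2` is bounded below by `-2`. -/
lemma hyperbolic_riccati_neg_two_le {y : ℝ → ℝ}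
    (hy : ∀ t : ℝ, HasDerivAt y (2 - (y t) ^ 2 / 2) t) (a : ℝ) : -2 ≤ y a := by
  by_contra! ha
  have hlt (t : ℝ) (hat : a ≤ t) : y t + 2 < 0 := by
    linarith [hyperbolic_riccati_lt_neg_two hy ha hat]
  -- The reciprocal of `y + 2` satisfies a linear equation, with the following first integral.
  set q : ℝ → ℝ := fun t => Real.exp (2 * t) / (y t + 2) - Real.exp (2 * t) / 4
  have hd (t : ℝ) (hat : a ≤ t) : HasDerivAt q 0 t := by
    have hne := (hlt t hat).ne
    have he : HasDerivAt (fun s : ℝ => Real.exp (2 * s)) (Real.exp (2 * t) * (2 * 1)) t :=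
      ((hasDerivAt_id t).const_mul 2).exp
    refine ((he.div ((hy t).add_const 2) hne).sub (he.div_const 4)).congr_deriv ?_
    field_simp
    ring
  set b := max a (-2 * q a)
  have hab : a ≤ b := le_max_left _ _
  have hconst : q b = q a :=
    constant_of_has_deriv_right_zero
      (fun t ht => (hd t ht.1).continuousAt.continuousWithinAt)
      (fun t ht => (hd t ht.1).hasDerivWithinAt) b ⟨hab, le_rfl⟩
  have hquot : Real.exp (2 * b) / (y b + 2) < 0 :=
    div_neg_of_pos_of_neg (Real.exp_pos _) (hlt b hab)
  have hqb : q b = Real.exp (2 * b) / (y b + 2) - Real.exp (2 * b) / 4 := rfl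
  linarith [Real.add_one_le_exp (2 * b), le_max_right a (-2 * q a)]

/-- Any globally defined differentiable solution of `y′ = 2 − y²/2` on `ℝ` takes values
in `[−2, 2]`. -/
theorem global_solution_bounded_hyperbolic
    (y : ℝ → ℝ) (hy : ∀ t : ℝ, HasDerivAt y (2 - (y t) ^ 2 / 2) t) :
    ∀ t : ℝ, -2 ≤ y t ∧ y t ≤ 2 := by
  intro t
  have hrev (s : ℝ) : HasDerivAt (fun s => -y (-s)) (2 - (-y (-s)) ^ 2 / 2) s := by
    refine (((hy (-s)).comp s (hasDerivAt_neg s)).neg).congr_deriv ?_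
    ring
  have h := hyperbolic_riccati_neg_two_le hrev (-t)
  rw [neg_neg] at h
  exact ⟨hyperbolic_riccati_neg_two_le hy t, by linarith⟩
end

section
/- If y : ℝ → ℝ is differentiable at every t ≥ 0 with y′(t) = 2 − y(t)²/2 for all t ≥ 0 and y(0) > −2, then y(t) → 2 as t → ∞. -/
open Set in
/-- A solution on `[0, ∞)` of the linear equation `w' = k w` with `k` continuous and `w 0 = 0`
vanishes identically. -/
theorem eq_zero_of_hasDerivAt_mul_self {w k : ℝ → ℝ} (hk : ContinuousOn k (Ici 0))
    (hw : ∀ t, 0 ≤ t → HasDerivAt w (k t * w t) t) (h0 : w 0 = 0) {t : ℝ} (ht : 0 ≤ t) :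
    w t = 0 := by
  obtain ⟨K, hK⟩ := (isCompact_Icc (a := (0 : ℝ)) (b := t)).exists_bound_of_continuousOn
    (hk.mono Icc_subset_Ici_self)
  have h := norm_le_gronwallBound_of_norm_deriv_right_le (f := w) (f' := fun s => k s * w s)
    (δ := 0) (K := K) (ε := 0) (a := 0) (b := t)
    (fun s hs => (hw s hs.1).continuousAt.continuousWithinAt)
    (fun s hs => (hw s hs.1).hasDerivWithinAt) (by simp [h0])
    (fun s hs => by
      rw [norm_mul, add_zero]
      exact mul_le_mul_of_nonneg_right (hK s ⟨hs.1, hs.2.le⟩) (norm_nonneg _))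
    t ⟨ht, le_rfl⟩
  simpa [gronwallBound_ε0] using h

/-- The explicit solution of the Riccati equation `y' = 2 - y² / 2`, in denominator-free form. -/
theorem riccati_solution_mul_eq {y : ℝ → ℝ}
    (hy : ∀ t : ℝ, 0 ≤ t → HasDerivAt y (2 - (y t) ^ 2 / 2) t) {t : ℝ} (ht : 0 ≤ t) :
    y t * ((2 + y 0) + (2 - y 0) * Real.exp (-2 * t)) =
      2 * ((2 + y 0) - (2 - y 0) * Real.exp (-2 * t)) := by
  refine sub_eq_zero.mp (eq_zero_of_hasDerivAt_mul_self (k := fun s => -(y s / 2 + 1))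
    (w := fun s => y s * ((2 + y 0) + (2 - y 0) * Real.exp (-2 * s)) -
      2 * ((2 + y 0) - (2 - y 0) * Real.exp (-2 * s))) ?_ (fun s hs => ?_) ?_ ht)
  · have hc : ContinuousOn y (Set.Ici 0) :=
      fun s hs => (hy s hs).continuousAt.continuousWithinAt
    fun_prop
  · have he : HasDerivAt (fun s : ℝ => (2 - y 0) * Real.exp (-2 * s))
        ((2 - y 0) * (Real.exp (-2 * s) * (-2 * 1))) s :=
      (((hasDerivAt_id s).const_mul (-2)).exp).const_mul _
    refine (((hy s hs).mul (he.const_add (2 + y 0))).sub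
      ((he.const_sub (2 + y 0)).const_mul 2)).congr_deriv ?_
    ring
  · simp only [mul_zero, Real.exp_zero]
    ring

/-- If `y` is differentiable at every `t ≥ 0` with `y′(t) = 2 − y(t)²/2` there and
`y(0) > −2`, then `y(t) → 2` as `t → ∞`. -/
theorem tendsto_two_hyperbolic
    (y : ℝ → ℝ) (hy : ∀ t : ℝ, 0 ≤ t → HasDerivAt y (2 - (y t) ^ 2 / 2) t)
    (h0 : y 0 > -2) :
    Filter.Tendsto y Filter.atTop (nhds 2) := by
  have hp : 2 + y 0 ≠ 0 := ne_of_gt (by linarith)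
  have he : Filter.Tendsto (fun t : ℝ => (2 - y 0) * Real.exp (-2 * t)) Filter.atTop (nhds 0) := by
    simpa using (Real.tendsto_exp_atBot.comp
      (Filter.tendsto_id.const_mul_atTop_of_neg (by norm_num : (-2 : ℝ) < 0))).const_mul (2 - y 0)
  have hden : Filter.Tendsto (fun t : ℝ => (2 + y 0) + (2 - y 0) * Real.exp (-2 * t))
      Filter.atTop (nhds (2 + y 0)) := by
    simpa using he.const_add (2 + y 0)
  have hnum : Filter.Tendsto (fun t : ℝ => 2 * ((2 + y 0) - (2 - y 0) * Real.exp (-2 * t)))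
      Filter.atTop (nhds (2 * (2 + y 0))) := by
    simpa using (he.const_sub (2 + y 0)).const_mul 2
  have hlim := hnum.div hden hp
  rw [mul_div_cancel_right₀ _ hp] at hlim
  refine hlim.congr' ?_
  filter_upwards [Filter.eventually_ge_atTop 0, hden.eventually_ne hp] with t ht hne
  exact (eq_div_of_mul_eq hne (riccati_solution_mul_eq hy ht)).symm
end
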